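/- (Theorem 3.1: DualDA attributions as influence values.) For ε ∈ ℝ define the perturbed objective F_ε on weight configurations W = (w_c)_{c∈[K]} by F_ε(W) := (1/2)∑_{c∈[K]} ‖w_c‖² + C ∑_{j=1}^N h_j(W) − ε·C·h_i(W), where h_j(W) := max_{c∈[K]} (1 − δ_{c,y_j} − ⟨w_{y_j}, f_j⟩ + ⟨w_c, f_j⟩) and i ∈ [N] is a fixed training index. Assume: (1) there is a neighborhood of 0 on which for each ε there is a unique global minimizer W(ε) of F_ε, and the map ε ↦ W(ε) is differentiable at ε = 0; (2) for every j ∈ [N] the maximizing index in h_j is unique at W(0), and let c* denote the unique maximizer in h_i at W(0); (3) the dual variables α = (α_{jc}) satisfy ∑_{c=1}^K α_{jc} = C and α_{jc} ≥ 0 for all j, c, the stationarity relation w_c(0) = ∑_{j=1}^N (C·δ_{y_j,c} − α_{jc}) f_j for all c ∈ [K], and complementary slackness at W(0): if the maximizer of h_j at W(0) equals y_j then α_{jc} = 0 for all c ≠ y_j, and if it equals some c' ≠ y_j then α_{jc} = 0 for all c ≠ c'. Then for every test feature f_x ∈ ℝ^d and every class c ∈ [K], the derivative at ε = 0 of the function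 ε ↦ ⟨w_c(0) − w_c(ε), f_x⟩ exists and equals the DualDA attribution τ_c(f_x, i) = λ_{ic}·⟨f_i, f_x⟩. -/

import Mathlib

open Finset RealInnerProductSpace

/-- The multiclass hinge `h_j(W) = max_{c∈[K]} (1 − δ_{c,y_j} − ⟨w_{y_j}, f_j⟩ + ⟨w_c, f_j⟩)`. -/
noncomputable def multiHinge {K d : ℕ} (hK : 0 < K)
    (fj : EuclideanSpace ℝ (Fin d)) (yj : Fin K)
    (W : Fin K → EuclideanSpace ℝ (Fin d)) : ℝ :=
  Finset.univ.sup' ⟨⟨0, hK⟩, Finset.mem_univ _⟩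
    fun c => 1 - (if c = yj then (1:ℝ) else 0) - ⟪W yj, fj⟫ + ⟪W c, fj⟫

/-- DualDA coefficient `λ_{jc}`: `C − α_{j,y_j}` if `c = y_j`, `−α_{jc}` otherwise. -/
def dualDACoeff {N K : ℕ} (y : Fin N → Fin K) (C : ℝ)
    (α : Fin N → Fin K → ℝ) (j : Fin N) (c : Fin K) : ℝ :=
  if c = y j then C - α j (y j) else -α j c

/-- `k` is the unique maximizing index of the multiclass hinge of a sample at `W`. -/
def IsStrictArgmax {K d : ℕ} (fj : EuclideanSpace ℝ (Fin d)) (yj k : Fin K)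
    (W : Fin K → EuclideanSpace ℝ (Fin d)) : Prop :=
  ∀ c : Fin K, c ≠ k →
    1 - (if c = yj then (1:ℝ) else 0) - ⟪W yj, fj⟫ + ⟪W c, fj⟫
      < 1 - (if k = yj then (1:ℝ) else 0) - ⟪W yj, fj⟫ + ⟪W k, fj⟫

theorem IsStrictArgmax.multiHinge_eq {K d : ℕ} (hK : 0 < K) {fj : EuclideanSpace ℝ (Fin d)}
    {yj k : Fin K} {W : Fin K → EuclideanSpace ℝ (Fin d)} (h : IsStrictArgmax fj yj k W) :
    multiHinge hK fj yj W = 1 - (if k = yj then (1:ℝ) else 0) - ⟪W yj, fj⟫ + ⟪W k, fj⟫ := by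
  refine le_antisymm (Finset.sup'_le _ _ fun c _ => ?_)
    (Finset.le_sup' (fun c => 1 - (if c = yj then (1:ℝ) else 0) - ⟪W yj, fj⟫ + ⟪W c, fj⟫)
      (Finset.mem_univ k))
  rcases eq_or_ne c k with rfl | hc
  · exact le_rfl
  · exact (h c hc).le

theorem IsStrictArgmax.eventually {K d : ℕ} {fj : EuclideanSpace ℝ (Fin d)} {yj k : Fin K}
    {W : Fin K → EuclideanSpace ℝ (Fin d)} (h : IsStrictArgmax fj yj k W) :
    ∀ᶠ W' in nhds W, IsStrictArgmax fj yj k W' := by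
  refine Filter.eventually_all.2 fun c => ?_
  by_cases hc : c = k
  · exact Filter.Eventually.of_forall fun _ hne => absurd hc hne
  · have hlt := ContinuousAt.eventually_lt (x₀ := W)
      (f := fun W' : Fin K → EuclideanSpace ℝ (Fin d) =>
        1 - (if c = yj then (1:ℝ) else 0) - ⟪W' yj, fj⟫ + ⟪W' c, fj⟫)
      (g := fun W' => 1 - (if k = yj then (1:ℝ) else 0) - ⟪W' yj, fj⟫ + ⟪W' k, fj⟫)
      (by fun_prop) (by fun_prop) (h c hc)
    exact hlt.mono fun _ hW' _ => hW'

theorem hasDerivAt_inner_add_smul {E : Type*} [NormedAddCommGroup E] [InnerProductSpace ℝ E]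
    (w v u : E) : HasDerivAt (fun t : ℝ => ⟪w + t • v, u⟫) ⟪v, u⟫ 0 := by
  simpa [inner_add_left, inner_smul_left] using
    ((hasDerivAt_id (0:ℝ)).mul_const ⟪v, u⟫).const_add ⟪w, u⟫

theorem hasDerivAt_norm_sq_add_smul {E : Type*} [NormedAddCommGroup E] [InnerProductSpace ℝ E]
    (w v : E) : HasDerivAt (fun t : ℝ => ‖w + t • v‖ ^ 2) (2 * ⟪w, v⟫) 0 := by
  simpa using (((hasDerivAt_id (0:ℝ)).smul_const v).const_add w).norm_sq

/-- Where the maximizing index is unique, the multiclass hinge is affine to first order. -/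
theorem IsStrictArgmax.hasDerivAt_multiHinge {K d : ℕ} (hK : 0 < K)
    {fj : EuclideanSpace ℝ (Fin d)} {yj k : Fin K} {W : Fin K → EuclideanSpace ℝ (Fin d)}
    (h : IsStrictArgmax fj yj k W) (V : Fin K → EuclideanSpace ℝ (Fin d)) :
    HasDerivAt (fun t : ℝ => multiHinge hK fj yj (W + t • V)) (⟪V k, fj⟫ - ⟪V yj, fj⟫) 0 := by
  have hline : Filter.Tendsto (fun t : ℝ => W + t • V) (nhds 0) (nhds W) := by
    have : Continuous (fun t : ℝ => W + t • V) := by fun_prop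
    simpa using this.tendsto 0
  have haff := ((hasDerivAt_inner_add_smul (W yj) (V yj) fj).const_sub
    (1 - (if k = yj then (1:ℝ) else 0))).add (hasDerivAt_inner_add_smul (W k) (V k) fj)
  refine (haff.congr_deriv (by ring)).congr_of_eventuallyEq ?_
  filter_upwards [hline.eventually h.eventually] with t ht
  simpa using ht.multiHinge_eq hK

/-- First-order optimality for the perturbed objective at a minimizer where all maximizing
indices are unique. -/
theorem perturbed_stationarity {N K d : ℕ} (hK : 0 < K)
    {f : Fin N → EuclideanSpace ℝ (Fin d)} {y : Fin N → Fin K} {C ε : ℝ} {i : Fin N}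
    {W : Fin K → EuclideanSpace ℝ (Fin d)} {m : Fin N → Fin K} {k : Fin K}
    (hm : ∀ j, IsStrictArgmax (f j) (y j) (m j) W) (hk : IsStrictArgmax (f i) (y i) k W)
    (hmin : ∀ V : Fin K → EuclideanSpace ℝ (Fin d),
      (1/2) * (∑ c, ‖W c‖^2) + C * (∑ j, multiHinge hK (f j) (y j) W)
          - ε * C * multiHinge hK (f i) (y i) W
        ≤ (1/2) * (∑ c, ‖V c‖^2) + C * (∑ j, multiHinge hK (f j) (y j) V)
          - ε * C * multiHinge hK (f i) (y i) V)
    (V : Fin K → EuclideanSpace ℝ (Fin d)) :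
    (∑ c, ⟪W c, V c⟫) + C * (∑ j, (⟪V (m j), f j⟫ - ⟪V (y j), f j⟫))
      - ε * C * (⟪V k, f i⟫ - ⟪V (y i), f i⟫) = 0 := by
  have hsq := (HasDerivAt.fun_sum (u := Finset.univ)
    fun c _ => hasDerivAt_norm_sq_add_smul (W c) (V c)).const_mul (1/2 : ℝ)
  have hloss := (HasDerivAt.fun_sum (u := Finset.univ)
    fun j _ => (hm j).hasDerivAt_multiHinge hK V).const_mul C
  have hderiv := (hsq.add hloss).sub ((hk.hasDerivAt_multiHinge hK V).const_mul (ε * C))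
  have hzero := IsLocalMin.hasDerivAt_eq_zero
    (Filter.Eventually.of_forall fun t => by simpa using hmin (W + t • V)) hderiv
  rw [← Finset.mul_sum] at hzero
  linarith

theorem dualDACoeff_eq {N K : ℕ} {y : Fin N → Fin K} {C : ℝ} {α : Fin N → Fin K → ℝ}
    {j : Fin N} {k : Fin K} (hsum : ∑ c, α j c = C) (hα : ∀ c, c ≠ k → α j c = 0) (c : Fin K) :
    dualDACoeff y C α j c = C * ((if c = y j then 1 else 0) - (if c = k then 1 else 0)) := by
  have hk : α j k = C := by
    rw [← hsum, Finset.sum_eq_single k (fun c _ hc => hα c hc) (by simp)]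
  have hval : ∀ c, α j c = if c = k then C else 0 := by
    intro c
    split_ifs with hc
    · rw [hc, hk]
    · exact hα c hc
  unfold dualDACoeff
  split_ifs with h1 h2 h2 <;> simp_all

theorem stmt13 (N K d : ℕ) (hK : 0 < K)
    (f : Fin N → EuclideanSpace ℝ (Fin d)) (y : Fin N → Fin K)
    (C : ℝ) (hC : 0 < C) (i : Fin N)
    -- the perturbed objective F_ε
    (F : ℝ → (Fin K → EuclideanSpace ℝ (Fin d)) → ℝ)
    (hF : ∀ (ε : ℝ) (W : Fin K → EuclideanSpace ℝ (Fin d)),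
      F ε W = (1/2) * (∑ c, ‖W c‖^2)
        + C * (∑ j, multiHinge hK (f j) (y j) W)
        - ε * C * multiHinge hK (f i) (y i) W)
    -- (1) unique global minimizers near 0, depending differentiably on ε
    (Wfun : ℝ → (Fin K → EuclideanSpace ℝ (Fin d)))
    (hmin : ∃ U ∈ nhds (0:ℝ), ∀ ε ∈ U,
      (∀ V : Fin K → EuclideanSpace ℝ (Fin d), F ε (Wfun ε) ≤ F ε V)
      ∧ (∀ W' : Fin K → EuclideanSpace ℝ (Fin d),
          (∀ V : Fin K → EuclideanSpace ℝ (Fin d), F ε W' ≤ F ε V) → W' = Wfun ε))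
    (hdiff : DifferentiableAt ℝ Wfun 0)
    -- (2) unique maximizing indices at W(0)
    (hargmax : ∀ j : Fin N, ∃ cj : Fin K, ∀ c : Fin K, c ≠ cj →
      1 - (if c = y j then (1:ℝ) else 0) - ⟪Wfun 0 (y j), f j⟫ + ⟪Wfun 0 c, f j⟫
        < 1 - (if cj = y j then (1:ℝ) else 0) - ⟪Wfun 0 (y j), f j⟫ + ⟪Wfun 0 cj, f j⟫)
    (cstar : Fin K)
    (hcstar : ∀ c : Fin K, c ≠ cstar →
      1 - (if c = y i then (1:ℝ) else 0) - ⟪Wfun 0 (y i), f i⟫ + ⟪Wfun 0 c, f i⟫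
        < 1 - (if cstar = y i then (1:ℝ) else 0) - ⟪Wfun 0 (y i), f i⟫ + ⟪Wfun 0 cstar, f i⟫)
    -- (3) dual variables: feasibility, stationarity, complementary slackness at W(0)
    (α : Fin N → Fin K → ℝ)
    (hsum : ∀ j : Fin N, ∑ c, α j c = C)
    (hnonneg : ∀ (j : Fin N) (c : Fin K), 0 ≤ α j c)
    (hstat : ∀ c : Fin K,
      Wfun 0 c = ∑ j, ((C * (if y j = c then (1:ℝ) else 0)) - α j c) • f j)
    (hcs : ∀ (j : Fin N) (cj : Fin K),
      (∀ c : Fin K, c ≠ cj →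
        1 - (if c = y j then (1:ℝ) else 0) - ⟪Wfun 0 (y j), f j⟫ + ⟪Wfun 0 c, f j⟫
          < 1 - (if cj = y j then (1:ℝ) else 0) - ⟪Wfun 0 (y j), f j⟫ + ⟪Wfun 0 cj, f j⟫) →
      (cj = y j → ∀ c : Fin K, c ≠ y j → α j c = 0)
      ∧ (cj ≠ y j → ∀ c : Fin K, c ≠ cj → α j c = 0)) :
    -- conclusion: influence of downweighting sample i equals the DualDA attribution
    ∀ (fx : EuclideanSpace ℝ (Fin d)) (c : Fin K),
      HasDerivAt (fun ε : ℝ => ⟪Wfun 0 c - Wfun ε c, fx⟫)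
        (dualDACoeff y C α i c * ⟪f i, fx⟫) 0 := by
  intro fx c
  obtain ⟨U, hU, hopt⟩ := hmin
  choose m hm using hargmax
  have hα : ∀ b, b ≠ cstar → α i b = 0 := by
    by_cases h : cstar = y i
    · intro b hb
      exact (hcs i cstar hcstar).1 h b (h ▸ hb)
    · exact (hcs i cstar hcstar).2 h
  have hstationary : ∀ ε ∈ U, (∀ j, IsStrictArgmax (f j) (y j) (m j) (Wfun ε)) →
      IsStrictArgmax (f i) (y i) cstar (Wfun ε) → _ := fun ε hε hmε hkε =>
    perturbed_stationarity hK (C := C) (ε := ε) hmε hkε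
      (fun V => by simpa only [hF] using (hopt ε hε).1 V) (Pi.single c fx)
  have hzero := hstationary 0 (mem_of_mem_nhds hU) hm hcstar
  have hmε : ∀ᶠ ε in nhds (0:ℝ), ∀ j, IsStrictArgmax (f j) (y j) (m j) (Wfun ε) :=
    Filter.eventually_all.2 fun j =>
      hdiff.continuousAt.eventually (IsStrictArgmax.eventually (hm j))
  have hkε : ∀ᶠ ε in nhds (0:ℝ), IsStrictArgmax (f i) (y i) cstar (Wfun ε) :=
    hdiff.continuousAt.eventually (IsStrictArgmax.eventually hcstar)
  have hinner : ∀ W : Fin K → EuclideanSpace ℝ (Fin d),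
      ∑ b, ⟪W b, (Pi.single c fx : Fin K → EuclideanSpace ℝ (Fin d)) b⟫ = ⟪W c, fx⟫ := by
    intro W
    rw [Finset.sum_eq_single c (fun b _ hb => by simp [hb]) (by simp), Pi.single_eq_same]
  have hsingle : ∀ b, ⟪(Pi.single c fx : Fin K → EuclideanSpace ℝ (Fin d)) b, f i⟫
      = (if c = b then 1 else 0) * ⟪f i, fx⟫ := by
    intro b
    rcases eq_or_ne c b with rfl | hb
    · simp [real_inner_comm]
    · simp [hb, hb.symm]
  have hlin := (hasDerivAt_id (0:ℝ)).mul_const (dualDACoeff y C α i c * ⟪f i, fx⟫)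
  rw [one_mul] at hlin
  refine hlin.congr_of_eventuallyEq ?_
  filter_upwards [hU, hmε, hkε] with ε hε hmε hkε
  have hpert := hstationary ε hε hmε hkε
  rw [hinner, hsingle, hsingle] at hpert hzero
  rw [inner_sub_left, dualDACoeff_eq (hsum i) hα, id]
  linear_combination hzero - hpert
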